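/- arXiv:math/0503498 — 5 statements merged into one kernel-verified Lean document; each statement's English description precedes it below -/
import Mathlib

section
/- For every natural number i, the alternating sum Σ_{l=0}^{i} (−1)^l (l+2) · C(3i+5, i−l) equals ((5i+8)/(3i+4)) · C(3i+4, i). -/
theorem sum_neg_one_pow_mul_choose_sub {R : Type*} [CommRing R] (n k : ℕ) :
    ∑ l ∈ Finset.range (k + 1), (-1 : R) ^ l * ((n + 1).choose (k - l) : R) = n.choose k := by
  induction k with
  | zero => simp
  | succ k ih =>
    have h : ∑ l ∈ Finset.range (k + 1),
        (-1 : R) ^ (l + 1) * ((n + 1).choose (k + 1 - (l + 1)) : R) = -(n.choose k : R) := by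
      rw [← ih, ← Finset.sum_neg_distrib]
      refine Finset.sum_congr rfl fun l _ => ?_
      rw [Nat.add_sub_add_right]
      ring
    rw [Finset.sum_range_succ', h, Nat.sub_zero, Nat.choose_succ_succ' n k]
    push_cast
    ring

theorem sum_neg_one_pow_mul_add_two_mul_choose_sub {R : Type*} [CommRing R] (n k : ℕ) :
    ∑ l ∈ Finset.range (k + 1), (-1 : R) ^ l * ((l : R) + 2) * ((n + 2).choose (k - l) : R) =
      n.choose k + (n + 1).choose k := by
  induction k with
  | zero => norm_num
  | succ k ih =>
    have h : ∑ l ∈ Finset.range (k + 1), (-1 : R) ^ (l + 1) * (((l + 1 : ℕ) : R) + 2) *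
        ((n + 2).choose (k + 1 - (l + 1)) : R) =
          -(n.choose k + (n + 1).choose k : R) - (n + 1).choose k := by
      rw [← ih, ← sum_neg_one_pow_mul_choose_sub (n + 1) k, ← Finset.sum_neg_distrib,
        ← Finset.sum_sub_distrib]
      refine Finset.sum_congr rfl fun l _ => ?_
      rw [Nat.add_sub_add_right]
      push_cast
      ring
    rw [Finset.sum_range_succ', h, Nat.sub_zero, Nat.choose_succ_succ' (n + 1) k,
      Nat.choose_succ_succ' n k]
    push_cast
    ring

/-- For every natural number `i`,
`Σ_{l=0}^{i} (−1)^l (l+2) · C(3i+5, i−l) = ((5i+8)/(3i+4)) · C(3i+4, i)`. -/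
theorem gamma_coefficient_identity (i : ℕ) :
    ∑ l ∈ Finset.range (i + 1),
      (-1 : ℚ) ^ l * ((l : ℚ) + 2) * (Nat.choose (3 * i + 5) (i - l) : ℚ) =
    ((5 * (i : ℚ) + 8) / (3 * (i : ℚ) + 4)) * (Nat.choose (3 * i + 4) i : ℚ) := by
  rw [sum_neg_one_pow_mul_add_two_mul_choose_sub (3 * i + 3) i]
  have h : ((3 * i + 3).choose i : ℚ) * (3 * i + 4) = (3 * i + 4).choose i * (2 * i + 4) := by
    have := Nat.choose_mul_succ_eq (3 * i + 3) i
    rw [show 3 * i + 3 + 1 - i = 2 * i + 4 by lia] at this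
    exact_mod_cast this
  have h0 : (3 * (i : ℚ) + 4) ≠ 0 := by positivity
  field_simp
  linear_combination h
end

section
/- For every natural number i, (3i+4) · Σ_{l=0}^{i} (−1)^l (3l+10) · C(3i+5, i−l) = (27i+40) · C(3i+4, i). -/
theorem sum_range_neg_one_pow_mul_choose_sub {R : Type*} [CommRing R] (n k : ℕ) :
    ∑ l ∈ Finset.range (k + 1), (-1 : R) ^ l * ((n + 1).choose (k - l) : R) =
      (n.choose k : R) := by
  induction k with
  | zero => simp
  | succ k ih =>
    rw [Finset.sum_range_succ']
    simp only [pow_succ, Nat.add_sub_add_right, mul_neg_one, neg_mul, Finset.sum_neg_distrib, ih,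
      pow_zero, one_mul, Nat.sub_zero, Nat.choose_succ_succ' n k]
    push_cast
    ring

theorem sum_range_neg_one_pow_mul_succ_mul_choose_sub {R : Type*} [CommRing R] (n k : ℕ) :
    ∑ l ∈ Finset.range (k + 1), (-1 : R) ^ l * ((l : R) + 1) * ((n + 2).choose (k - l) : R) =
      (n.choose k : R) := by
  induction k with
  | zero => simp
  | succ k ih =>
    have shift : ∑ l ∈ Finset.range (k + 1),
        (-1 : R) ^ (l + 1) * (((l + 1 : ℕ) : R) + 1) * ((n + 2).choose (k + 1 - (l + 1)) : R) =
          -(n.choose k : R) - ((n + 1).choose k : R) := by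
      rw [← sum_range_neg_one_pow_mul_choose_sub (n + 1) k, ← ih, ← Finset.sum_neg_distrib,
        ← Finset.sum_sub_distrib]
      refine Finset.sum_congr rfl fun l _ => ?_
      rw [Nat.add_sub_add_right]
      push_cast
      ring
    rw [Finset.sum_range_succ', shift, Nat.sub_zero, Nat.choose_succ_succ' (n + 1) k,
      Nat.choose_succ_succ' n k]
    push_cast
    ring

/-- For every natural number `i`,
`(3i+4) · Σ_{l=0}^{i} (−1)^l (3l+10) · C(3i+5, i−l) = (27i+40) · C(3i+4, i)`. -/
theorem eta_coefficient_identity (i : ℕ) :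
    (3 * (i : ℚ) + 4) *
      ∑ l ∈ Finset.range (i + 1),
        (-1 : ℚ) ^ l * (3 * (l : ℚ) + 10) * (Nat.choose (3 * i + 5) (i - l) : ℚ) =
    (27 * (i : ℚ) + 40) * (Nat.choose (3 * i + 4) i : ℚ) := by
  have sum_eq : ∑ l ∈ Finset.range (i + 1),
      (-1 : ℚ) ^ l * (3 * (l : ℚ) + 10) * (Nat.choose (3 * i + 5) (i - l) : ℚ) =
        3 * ((3 * i + 3).choose i : ℚ) + 7 * ((3 * i + 4).choose i : ℚ) := by
    rw [← sum_range_neg_one_pow_mul_succ_mul_choose_sub (3 * i + 3) i,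
      ← sum_range_neg_one_pow_mul_choose_sub (3 * i + 4) i, Finset.mul_sum, Finset.mul_sum,
      ← Finset.sum_add_distrib]
    refine Finset.sum_congr rfl fun l _ => ?_
    ring
  have absorb : ((3 * i + 3).choose i : ℚ) * (3 * i + 4) =
      ((3 * i + 4).choose i : ℚ) * (2 * i + 4) := by
    have h := Nat.choose_mul_succ_eq (3 * i + 3) i
    rw [show 3 * i + 3 + 1 - i = 2 * i + 4 by omega] at h
    exact_mod_cast h
  rw [sum_eq]
  linear_combination 3 * absorb
end

section
/- For every natural number i, Σ_{l=0}^{i} (−1)^l [ (3i+4)((9i+12)l + 12i+15) · C(3i+4, i−l−1) + (l+2)((3l+4)(3i+4)−1) · C(3i+5, i−l) ] = ((27i^4+153i^3+331i^2+323i+120)/((3i+4)(i+1))) · C(3i+4, i). -/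
/-- The binomial coefficient `C(n, m)` for a natural upper index `n` and an
integer lower index `m`, which vanishes when `m < 0` (and when `m > n`). -/
def chooseZ (n : ℕ) (m : ℤ) : ℚ :=
  if 0 ≤ m then (Nat.choose n m.toNat : ℚ) else 0

/-- Truncated alternating row sum of binomial coefficients. -/
theorem sum_alternating_choose (n m : ℕ) :
    ∑ l ∈ Finset.range (m + 1), (-1 : ℚ) ^ l * (Nat.choose (n + 1) (m - l) : ℚ) =
      (Nat.choose n m : ℚ) := by
  induction m with
  | zero => simp
  | succ m ih =>
    rw [Finset.sum_range_succ']
    simp only [Nat.add_sub_add_right, pow_succ, mul_neg, mul_one, neg_mul,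
      Finset.sum_neg_distrib, ih]
    simp [Nat.choose_succ_succ' n m]

/-- First moment of the truncated alternating row sum of binomial coefficients. -/
theorem sum_alternating_mul_choose (n m : ℕ) :
    ∑ l ∈ Finset.range (m + 2),
      (-1 : ℚ) ^ l * ((l : ℚ) * (Nat.choose (n + 2) (m + 1 - l) : ℚ)) =
      -(Nat.choose n m : ℚ) := by
  have shift (k : ℕ) :
      ∑ l ∈ Finset.range (k + 2),
        (-1 : ℚ) ^ l * ((l : ℚ) * (Nat.choose (n + 2) (k + 1 - l) : ℚ)) =
      -(∑ l ∈ Finset.range (k + 1),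
          (-1 : ℚ) ^ l * ((l : ℚ) * (Nat.choose (n + 2) (k - l) : ℚ))) -
        (Nat.choose (n + 1) k : ℚ) := by
    rw [Finset.sum_range_succ', ← sum_alternating_choose (n + 1) k, ← Finset.sum_neg_distrib,
      ← Finset.sum_sub_distrib]
    simp only [Nat.cast_zero, zero_mul, mul_zero, add_zero]
    refine Finset.sum_congr rfl fun l _ => ?_
    rw [Nat.add_sub_add_right]
    push_cast
    ring
  induction m with
  | zero => rw [shift]; simp
  | succ m ih =>
    rw [shift, ih, Nat.choose_succ_succ' n m]
    push_cast
    ring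

/-- Second moment of the truncated alternating row sum of binomial coefficients. -/
theorem sum_alternating_sq_mul_choose (n m : ℕ) :
    ∑ l ∈ Finset.range (m + 3),
      (-1 : ℚ) ^ l * ((l : ℚ) ^ 2 * (Nat.choose (n + 3) (m + 2 - l) : ℚ)) =
      (Nat.choose n m : ℚ) - (Nat.choose n (m + 1) : ℚ) := by
  have shift (k : ℕ) :
      ∑ l ∈ Finset.range (k + 3),
        (-1 : ℚ) ^ l * ((l : ℚ) ^ 2 * (Nat.choose (n + 3) (k + 2 - l) : ℚ)) =
      -(∑ l ∈ Finset.range (k + 2),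
          (-1 : ℚ) ^ l * ((l : ℚ) ^ 2 * (Nat.choose (n + 3) (k + 1 - l) : ℚ))) +
        2 * (Nat.choose (n + 1) k : ℚ) - (Nat.choose (n + 2) (k + 1) : ℚ) := by
    have h₁ := sum_alternating_mul_choose (n + 1) k
    rw [Finset.sum_range_succ', ← sum_alternating_choose (n + 2) (k + 1),
      ← neg_neg (Nat.choose (n + 1) k : ℚ), ← h₁, mul_neg, Finset.mul_sum,
      ← Finset.sum_neg_distrib, ← Finset.sum_neg_distrib, ← Finset.sum_add_distrib,
      ← Finset.sum_sub_distrib]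
    simp only [Nat.cast_zero, ne_eq, OfNat.ofNat_ne_zero, not_false_eq_true, zero_pow,
      zero_mul, mul_zero, add_zero]
    refine Finset.sum_congr rfl fun l _ => ?_
    rw [show k + 2 - (l + 1) = k + 1 - l by omega]
    push_cast
    ring
  induction m with
  | zero =>
    rw [shift]
    simp [Finset.sum_range_succ]
  | succ m ih =>
    rw [shift, ih]
    simp only [Nat.choose_succ_succ']
    push_cast
    ring

theorem chooseZ_natCast (n m : ℕ) : chooseZ n (m : ℤ) = (Nat.choose n m : ℚ) := by
  simp [chooseZ]

theorem chooseZ_of_neg (n : ℕ) {m : ℤ} (hm : m < 0) : chooseZ n m = 0 := by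
  simp [chooseZ, hm]

/-- An alternating sum against `chooseZ n (i - l - 1)` drops its vanishing last term. -/
theorem sum_mul_chooseZ_sub_one (f : ℕ → ℚ) (n k : ℕ) :
    ∑ l ∈ Finset.range (k + 2), f l * chooseZ n (((k + 1 : ℕ) : ℤ) - (l : ℤ) - 1) =
      ∑ l ∈ Finset.range (k + 1), f l * (Nat.choose n (k - l) : ℚ) := by
  rw [Finset.sum_range_succ, chooseZ_of_neg n (by omega), mul_zero, add_zero]
  refine Finset.sum_congr rfl fun l hl => ?_
  have hl' := Finset.mem_range.mp hl
  rw [← chooseZ_natCast]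
  congr 2
  omega

/-- For every natural number `i`,
`Σ_{l=0}^{i} (−1)^l [(3i+4)((9i+12)l + 12i+15)·C(3i+4, i−l−1)
  + (l+2)((3l+4)(3i+4)−1)·C(3i+5, i−l)]
  = ((27i^4+153i^3+331i^2+323i+120)/((3i+4)(i+1))) · C(3i+4, i)`. -/
theorem x_coefficient_identity (i : ℕ) :
    ∑ l ∈ Finset.range (i + 1),
      (-1 : ℚ) ^ l *
        ((3 * (i : ℚ) + 4) * ((9 * (i : ℚ) + 12) * (l : ℚ) + 12 * (i : ℚ) + 15) *
            chooseZ (3 * i + 4) ((i : ℤ) - (l : ℤ) - 1) +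
          ((l : ℚ) + 2) * ((3 * (l : ℚ) + 4) * (3 * (i : ℚ) + 4) - 1) *
            (Nat.choose (3 * i + 5) (i - l) : ℚ)) =
    ((27 * (i : ℚ) ^ 4 + 153 * (i : ℚ) ^ 3 + 331 * (i : ℚ) ^ 2 + 323 * (i : ℚ) + 120) /
        ((3 * (i : ℚ) + 4) * ((i : ℚ) + 1))) * (Nat.choose (3 * i + 4) i : ℚ) := by
  match i with
  | 0 => norm_num [Finset.sum_range_succ, chooseZ]
  | 1 => norm_num [Finset.sum_range_succ, chooseZ, Nat.choose]
  | k + 2 =>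
    have a₀ := (sum_mul_chooseZ_sub_one (fun l => (-1 : ℚ) ^ l) (3 * k + 10) (k + 1)).trans
      (sum_alternating_choose (3 * k + 9) (k + 1))
    have a₁ := (sum_mul_chooseZ_sub_one (fun l => (-1 : ℚ) ^ l * l) (3 * k + 10) (k + 1)).trans
      (by simpa only [mul_assoc] using sum_alternating_mul_choose (3 * k + 8) k)
    have b₀ := sum_alternating_choose (3 * k + 10) (k + 2)
    have b₁ := sum_alternating_mul_choose (3 * k + 9) (k + 1)
    have b₂ := sum_alternating_sq_mul_choose (3 * k + 8) k
    have r₁ : (Nat.choose (3 * k + 8) (k + 1) : ℚ) * (k + 1) =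
        Nat.choose (3 * k + 8) k * (2 * k + 8) := by
      have h := Nat.choose_succ_right_eq (3 * k + 8) k
      rw [show 3 * k + 8 - k = 2 * k + 8 by omega] at h
      exact_mod_cast h
    have r₂ : (Nat.choose (3 * k + 8) (k + 2) : ℚ) * (k + 2) =
        Nat.choose (3 * k + 8) (k + 1) * (2 * k + 7) := by
      have h := Nat.choose_succ_right_eq (3 * k + 8) (k + 1)
      rw [show 3 * k + 8 - (k + 1) = 2 * k + 7 by omega] at h
      exact_mod_cast h
    have split (x : ℚ) :
        ∑ l ∈ Finset.range (k + 3),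
          (-1 : ℚ) ^ l *
            ((3 * x + 4) * ((9 * x + 12) * (l : ℚ) + 12 * x + 15) *
                chooseZ (3 * k + 10) (((k + 2 : ℕ) : ℤ) - (l : ℤ) - 1) +
              ((l : ℚ) + 2) * ((3 * (l : ℚ) + 4) * (3 * x + 4) - 1) *
                (Nat.choose (3 * k + 11) (k + 2 - l) : ℚ)) =
        (3 * x + 4) * (9 * x + 12) * -(Nat.choose (3 * k + 8) k : ℚ) +
          (3 * x + 4) * (12 * x + 15) * (Nat.choose (3 * k + 9) (k + 1) : ℚ) +
          (3 * (3 * x + 4) *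
              ((Nat.choose (3 * k + 8) k : ℚ) - (Nat.choose (3 * k + 8) (k + 1) : ℚ)) +
            (10 * (3 * x + 4) - 1) * -(Nat.choose (3 * k + 9) (k + 1) : ℚ) +
            (8 * (3 * x + 4) - 2) * (Nat.choose (3 * k + 10) (k + 2) : ℚ)) := by
      rw [← a₁, ← b₁, ← a₀, ← b₂, ← b₀]
      simp only [Finset.mul_sum, ← Finset.sum_add_distrib]
      refine Finset.sum_congr rfl fun l _ => ?_
      ring
    rw [show 3 * (k + 2) + 4 = 3 * k + 10 by ring, show 3 * (k + 2) + 5 = 3 * k + 11 by ring,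
      split]
    have hk₁ : (k : ℚ) + 1 ≠ 0 := by positivity
    have hk₂ : (k : ℚ) + 2 ≠ 0 := by positivity
    have hk₃ : (k : ℚ) + 3 ≠ 0 := by positivity
    have hk₄ : 3 * (k : ℚ) + 10 ≠ 0 := by positivity
    simp only [Nat.choose_succ_succ' (3 * k + 9), Nat.choose_succ_succ' (3 * k + 8)]
    rw [← eq_div_iff hk₁] at r₁
    rw [← eq_div_iff hk₂, r₁] at r₂
    push_cast
    rw [r₂, r₁, show 3 * ((k : ℚ) + 2) + 4 = 3 * k + 10 by ring,
      show (k : ℚ) + 2 + 1 = k + 3 by ring]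
    field_simp
    ring
end

section
/- For every natural number i, Σ_{l=0}^{i} (−1)^l [ C(3i+6+l, l+2) · C(3i+4, i−l−1) + ((l+2)(3i+6+l)/((3i+5)(3i+4))) · C(3i+5+l, l+2) · C(3i+5, i−l) ] = (3i+6) · C(3i+4, i). -/
theorem sum_neg_one_pow_mul_choose_add_mul_choose (m n : ℕ) :
    ∑ k ∈ Finset.range (n + 1),
      (-1 : ℤ) ^ k * ((m + k).choose k : ℤ) * (m.choose (n - k) : ℤ) = (-1) ^ n := by
  have choose_neg_cast (d k : ℕ) :
      Ring.choose (-((d : ℤ) + 1)) k = (-1) ^ k * ((d + k).choose k : ℤ) := by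
    have h : (d : ℤ) + 1 + k - 1 = ((d + k : ℕ) : ℤ) := by push_cast; ring
    rw [Ring.choose_neg, h, Ring.choose_natCast]
    simp [Int.negOnePow_def, Units.smul_def]
  have vandermonde :=
    Ring.add_choose_eq n (Commute.all (-((m : ℤ) + 1)) (m : ℤ))
  rw [Finset.Nat.sum_antidiagonal_eq_sum_range_succ_mk,
    show -((m : ℤ) + 1) + m = -(((0 : ℕ) : ℤ) + 1) by push_cast; ring] at vandermonde
  simp only [choose_neg_cast, Ring.choose_natCast] at vandermonde
  simpa using vandermonde.symm

theorem div_mul_choose_eq_choose (n l : ℕ) :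
    (((l : ℚ) + 2) * ((n : ℚ) + 3 + l) / (((n : ℚ) + 2) * ((n : ℚ) + 1))) *
      ((n + 2 + l).choose (l + 2) : ℚ) = ((n + 3 + l).choose (l + 1) : ℚ) := by
  have h₁ := Nat.choose_succ_right_eq (n + 2 + l) (l + 1)
  have h₂ := Nat.choose_mul_succ_eq (n + 2 + l) (l + 1)
  rw [show n + 2 + l - (l + 1) = n + 1 by omega] at h₁
  rw [show n + 2 + l + 1 - (l + 1) = n + 2 by omega,
    show n + 2 + l + 1 = n + 3 + l by omega] at h₂
  qify at h₁ h₂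
  rw [div_mul_eq_mul_div, div_eq_iff (by positivity)]
  linear_combination ((n : ℚ) + 3 + l) * h₁ + ((n : ℚ) + 1) * h₂

theorem chooseZ_natCast_s7 (n k : ℕ) : chooseZ n k = (n.choose k : ℚ) := by
  simp [chooseZ]

/-- For every natural number `i`,
`Σ_{l=0}^{i} (−1)^l [C(3i+6+l, l+2)·C(3i+4, i−l−1)
  + ((l+2)(3i+6+l)/((3i+5)(3i+4)))·C(3i+5+l, l+2)·C(3i+5, i−l)]
  = (3i+6) · C(3i+4, i)`. -/
theorem first_chern_class_H_identity (i : ℕ) :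
    ∑ l ∈ Finset.range (i + 1),
      (-1 : ℚ) ^ l *
        ((Nat.choose (3 * i + 6 + l) (l + 2) : ℚ) *
            chooseZ (3 * i + 4) ((i : ℤ) - (l : ℤ) - 1) +
          (((l : ℚ) + 2) * (3 * (i : ℚ) + 6 + (l : ℚ)) /
              ((3 * (i : ℚ) + 5) * (3 * (i : ℚ) + 4))) *
            (Nat.choose (3 * i + 5 + l) (l + 2) : ℚ) *
            (Nat.choose (3 * i + 5) (i - l) : ℚ)) =
    (3 * (i : ℚ) + 6) * (Nat.choose (3 * i + 4) i : ℚ) := by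
  have first_sum :
      ∑ l ∈ Finset.range (i + 1), (-1 : ℚ) ^ l * (((3 * i + 6 + l).choose (l + 2) : ℚ) *
          chooseZ (3 * i + 4) ((i : ℤ) - (l : ℤ) - 1)) =
        (-1) ^ (i + 1) + (3 * i + 5) * ((3 * i + 4).choose i : ℚ) -
          ((3 * i + 4).choose (i + 1) : ℚ) := by
    have key := sum_neg_one_pow_mul_choose_add_mul_choose (3 * i + 4) (i + 1)
    rw [Finset.sum_range_succ', Finset.sum_range_succ'] at key
    qify at key
    have last : chooseZ (3 * i + 4) ((i : ℤ) - (i : ℤ) - 1) = 0 := by simp [chooseZ]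
    rw [Finset.sum_range_succ, last]
    have h : ∑ l ∈ Finset.range i, (-1 : ℚ) ^ l * (((3 * i + 6 + l).choose (l + 2) : ℚ) *
          chooseZ (3 * i + 4) ((i : ℤ) - (l : ℤ) - 1)) =
        ∑ l ∈ Finset.range i, (-1 : ℚ) ^ (l + 1 + 1) *
          ((3 * i + 4 + (l + 1 + 1)).choose (l + 1 + 1) : ℚ) *
          ((3 * i + 4).choose (i + 1 - (l + 1 + 1)) : ℚ) := by
      refine Finset.sum_congr rfl fun l hl => ?_
      have hl := Finset.mem_range.mp hl
      rw [show (i : ℤ) - l - 1 = ((i + 1 - (l + 1 + 1) : ℕ) : ℤ) by omega, chooseZ_natCast_s7,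
        show 3 * i + 4 + (l + 1 + 1) = 3 * i + 6 + l by omega]
      ring
    rw [h]
    simp at key ⊢
    linear_combination key
  have second_sum :
      ∑ l ∈ Finset.range (i + 1), (-1 : ℚ) ^ l *
          (((3 * i + 6 + l).choose (l + 1) : ℚ) * ((3 * i + 5).choose (i - l) : ℚ)) =
        ((3 * i + 5).choose (i + 1) : ℚ) - (-1) ^ (i + 1) := by
    have key := sum_neg_one_pow_mul_choose_add_mul_choose (3 * i + 5) (i + 1)
    rw [Finset.sum_range_succ'] at key
    qify at key
    have h : ∑ l ∈ Finset.range (i + 1), (-1 : ℚ) ^ l *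
          (((3 * i + 6 + l).choose (l + 1) : ℚ) * ((3 * i + 5).choose (i - l) : ℚ)) =
        -∑ l ∈ Finset.range (i + 1), (-1 : ℚ) ^ (l + 1) *
          ((3 * i + 5 + (l + 1)).choose (l + 1) : ℚ) *
          ((3 * i + 5).choose (i + 1 - (l + 1)) : ℚ) := by
      rw [← Finset.sum_neg_distrib]
      refine Finset.sum_congr rfl fun l _ => ?_
      rw [show 3 * i + 5 + (l + 1) = 3 * i + 6 + l by omega, Nat.add_sub_add_right]
      ring
    rw [h]
    simp at key ⊢
    linear_combination -key
  have ratio (l : ℕ) : (((l : ℚ) + 2) * (3 * (i : ℚ) + 6 + (l : ℚ)) /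
      ((3 * (i : ℚ) + 5) * (3 * (i : ℚ) + 4))) *
        ((3 * i + 5 + l).choose (l + 2) : ℚ) = ((3 * i + 6 + l).choose (l + 1) : ℚ) := by
    rw [← div_mul_choose_eq_choose (3 * i + 3) l]
    push_cast
    ring_nf
  have pascal : ((3 * i + 5).choose (i + 1) : ℚ) =
      ((3 * i + 4).choose i : ℚ) + ((3 * i + 4).choose (i + 1) : ℚ) := by
    exact_mod_cast Nat.choose_succ_succ (3 * i + 4) i
  simp only [ratio, mul_add ((-1 : ℚ) ^ _), Finset.sum_add_distrib, first_sum, second_sum, pascal]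
  ring
end

section
/- For all integers i ≥ 0 and j with 2 ≤ j ≤ 2i+2, one has j! · (6i+10−j)! · Σ_{α=0}^{j+1} (j−2α−1)(j−2α)(j−2α+1)^2 / ( (3i+5−α)! · (3i+5+α−j)! · (j−α+1)! · α! ) = 6(j+1) · C(6i+10−j, 3i+6) · C(6i+8, j) / C(3i+4, j), where the sum is taken in the rational numbers and the factors (j−2α−1), (j−2α), (j−2α+1) are (possibly negative) integers. -/
/-- A weighted Vandermonde identity: the `r`-th factorial moment of the hypergeometric
distribution. -/
theorem sum_descFactorial_mul_choose_mul_choose (r N M n : ℕ) :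
    (∑ a ∈ Finset.range (n + 1), a.descFactorial r * (N.choose a * M.choose (n - a))) *
        (N + M).descFactorial r =
      (N + M).choose n * n.descFactorial r * N.descFactorial r := by
  induction r generalizing N n with
  | zero =>
    simp [Nat.add_choose_eq, Finset.Nat.sum_antidiagonal_eq_sum_range_succ_mk]
  | succ r ih =>
    rw [Finset.sum_range_succ']
    rcases N with _ | N
    · simp
    rcases n with _ | n
    · simp
    have key : ∑ a ∈ Finset.range (n + 1), (a + 1).descFactorial (r + 1) *
        ((N + 1).choose (a + 1) * M.choose (n + 1 - (a + 1))) =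
        (N + 1) * ∑ a ∈ Finset.range (n + 1),
          a.descFactorial r * (N.choose a * M.choose (n - a)) := by
      rw [Finset.mul_sum]
      refine Finset.sum_congr rfl fun a _ => ?_
      rw [Nat.succ_descFactorial_succ, Nat.add_sub_add_right]
      calc _ = (N + 1).choose (a + 1) * (a + 1) * (a.descFactorial r * M.choose (n - a)) := by
            ring
        _ = _ := by rw [← Nat.add_one_mul_choose_eq]; ring
    rw [key, Nat.zero_descFactorial_succ, zero_mul, add_zero,
      show N + 1 + M = N + M + 1 by ring]
    simp only [Nat.succ_descFactorial_succ]
    have h := Nat.add_one_mul_choose_eq (N + M) n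
    calc _ = (N + 1) * (N + M + 1) * ((∑ a ∈ Finset.range (n + 1),
          a.descFactorial r * (N.choose a * M.choose (n - a))) *
            (N + M).descFactorial r) := by ring
      _ = (N + 1) * ((N + M + 1) * (N + M).choose n) *
          (n.descFactorial r * N.descFactorial r) := by rw [ih]; ring
      _ = _ := by rw [h]; ring

/-- A quartic polynomial in `a`, averaged against the Vandermonde weights of
`(N + (N + 1)).choose n`. -/
theorem sum_quartic_mul_choose_mul_choose (N n : ℕ) (hN : 2 ≤ N) :
    (∑ a ∈ Finset.range (n + 1), ((n : ℚ) - 2 * a - 2) * (n - 2 * a - 1) * (n - 2 * a) ^ 2 *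
        (N.choose a * (N + 1).choose (n - a))) *
        ((2 * (N : ℚ) + 1) * 2 * (2 * N - 1)) =
      6 * (n : ℚ) ^ 2 * (2 * N + 1 - n) * (2 * N - n) * (2 * N + 1).choose n := by
  set S : ℕ → ℚ := fun r => ∑ a ∈ Finset.range (n + 1),
    (a.descFactorial r : ℚ) * (N.choose a * (N + 1).choose (n - a)) with hS
  have moment (r : ℕ) : S r * ((2 * N + 1).descFactorial r : ℚ) =
      (2 * N + 1).choose n * n.descFactorial r * N.descFactorial r := by
    have h := sum_descFactorial_mul_choose_mul_choose r N (N + 1) n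
    rw [show N + (N + 1) = 2 * N + 1 by ring] at h
    simp only [hS]
    exact_mod_cast h
  have cast_desc (a : ℕ) : (a.descFactorial 0 : ℚ) = 1 ∧ (a.descFactorial 1 : ℚ) = a ∧
      (a.descFactorial 2 : ℚ) = a * (a - 1) ∧
      (a.descFactorial 3 : ℚ) = a * (a - 1) * (a - 2) ∧
      (a.descFactorial 4 : ℚ) = a * (a - 1) * (a - 2) * (a - 3) := by
    simp only [← descPochhammer_eval_eq_descFactorial ℚ]
    simp [descPochhammer_succ_right, descPochhammer_zero]
  let g : ℚ → ℚ := fun a => (n - 2 * a - 2) * (n - 2 * a - 1) * (n - 2 * a) ^ 2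
  have expand : ∑ a ∈ Finset.range (n + 1),
      ((n : ℚ) - 2 * a - 2) * (n - 2 * a - 1) * (n - 2 * a) ^ 2 *
        (N.choose a * (N + 1).choose (n - a)) =
      g 0 * S 0 + (g 1 - g 0) * S 1 + (g 2 - 2 * g 1 + g 0) / 2 * S 2 +
        (g 3 - 3 * g 2 + 3 * g 1 - g 0) / 6 * S 3 + 16 * S 4 := by
    simp only [hS, Finset.mul_sum, ← Finset.sum_add_distrib]
    refine Finset.sum_congr rfl fun a _ => ?_
    obtain ⟨h0, h1, h2, h3, h4⟩ := cast_desc a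
    rw [h0, h1, h2, h3, h4]
    simp only [g]
    ring
  have hN' : (2 : ℚ) ≤ N := by exact_mod_cast hN
  have e1 : (2 * N + 1 : ℚ) ≠ 0 := by positivity
  have e2 : (N : ℚ) ≠ 0 := by positivity
  have e3 : (2 * N - 1 : ℚ) ≠ 0 := by linarith
  have e4 : (N - 1 : ℚ) ≠ 0 := by linarith
  obtain ⟨m0, m1, m2, m3, m4⟩ := cast_desc (2 * N + 1)
  obtain ⟨n0, n1, n2, n3, n4⟩ := cast_desc n
  obtain ⟨k0, k1, k2, k3, k4⟩ := cast_desc N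
  have s0 := moment 0
  have s1 := moment 1
  have s2 := moment 2
  have s3 := moment 3
  have s4 := moment 4
  rw [m0, n0, k0] at s0
  rw [m1, n1, k1] at s1
  rw [m2, n2, k2] at s2
  rw [m3, n3, k3] at s3
  rw [m4, n4, k4] at s4
  push_cast at s0 s1 s2 s3 s4
  set C : ℚ := ((2 * N + 1).choose n : ℚ)
  have t0 : S 0 = C := by linear_combination s0
  have t1 : S 1 = C * n * N / (2 * N + 1) := by
    field_simp
    linear_combination s1
  have t2 : S 2 = C * n * (n - 1) * (N - 1) / (2 * (2 * N + 1)) := by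
    field_simp
    refine mul_left_cancel₀ e2 ?_
    linear_combination s2
  have t3 : S 3 = C * n * (n - 1) * (n - 2) * (N - 1) * (N - 2) /
      (2 * (2 * N + 1) * (2 * N - 1)) := by
    field_simp
    refine mul_left_cancel₀ e2 ?_
    linear_combination s3
  have t4 : S 4 = C * n * (n - 1) * (n - 2) * (n - 3) * (N - 2) * (N - 3) /
      (4 * (2 * N + 1) * (2 * N - 1)) := by
    field_simp
    refine mul_left_cancel₀ (mul_ne_zero e2 e4) ?_
    linear_combination s4
  rw [expand, t0, t1, t2, t3, t4]
  simp only [g]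
  field_simp
  ring

/-- For all integers `i ≥ 0` and `j` with `2 ≤ j ≤ 2i+2`,
`j! · (6i+10−j)! · Σ_{α=0}^{j+1} (j−2α−1)(j−2α)(j−2α+1)^2 /
  ((3i+5−α)!·(3i+5+α−j)!·(j−α+1)!·α!)
  = 6(j+1) · C(6i+10−j, 3i+6) · C(6i+8, j) / C(3i+4, j)`. -/
theorem aleph_correction_term_identity (i j : ℕ) (hj2 : 2 ≤ j) (hj : j ≤ 2 * i + 2) :
    (Nat.factorial j : ℚ) * (Nat.factorial (6 * i + 10 - j) : ℚ) *
      ∑ α ∈ Finset.range (j + 2),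
        ((((j : ℤ) - 2 * (α : ℤ) - 1) * ((j : ℤ) - 2 * (α : ℤ)) *
            ((j : ℤ) - 2 * (α : ℤ) + 1) ^ 2 : ℤ) : ℚ) /
          ((Nat.factorial (3 * i + 5 - α) : ℚ) * (Nat.factorial (3 * i + 5 + α - j) : ℚ) *
            (Nat.factorial (j + 1 - α) : ℚ) * (Nat.factorial α : ℚ)) =
    6 * ((j : ℚ) + 1) * (Nat.choose (6 * i + 10 - j) (3 * i + 6) : ℚ) *
      (Nat.choose (6 * i + 8) j : ℚ) / (Nat.choose (3 * i + 4) j : ℚ) := by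
  obtain ⟨N, hN⟩ : ∃ N, N = 3 * i + 5 := ⟨_, rfl⟩
  obtain ⟨m, hm⟩ : ∃ m, N = m + j + 1 := ⟨N - 1 - j, by omega⟩
  have weight : ∀ α ∈ Finset.range (j + 2),
      ((((j : ℤ) - 2 * (α : ℤ) - 1) * ((j : ℤ) - 2 * (α : ℤ)) *
            ((j : ℤ) - 2 * (α : ℤ) + 1) ^ 2 : ℤ) : ℚ) /
          ((Nat.factorial (3 * i + 5 - α) : ℚ) * (Nat.factorial (3 * i + 5 + α - j) : ℚ) *
            (Nat.factorial (j + 1 - α) : ℚ) * (Nat.factorial α : ℚ)) =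
        (((j + 1 : ℕ) : ℚ) - 2 * α - 2) * ((j + 1 : ℕ) - 2 * α - 1) *
          ((j + 1 : ℕ) - 2 * α) ^ 2 * (N.choose α * (N + 1).choose (j + 1 - α)) /
          (N.factorial * (N + 1).factorial) := by
    intro α hα
    have hα' : α ≤ j + 1 := by simpa [Nat.lt_succ_iff] using hα
    rw [Nat.cast_choose ℚ (show α ≤ N by omega),
      Nat.cast_choose ℚ (show j + 1 - α ≤ N + 1 by omega),
      show N + 1 - (j + 1 - α) = 3 * i + 5 + α - j by omega, ← hN]
    have f1 := Nat.cast_ne_zero (R := ℚ).2 N.factorial_ne_zero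
    have f2 := Nat.cast_ne_zero (R := ℚ).2 (N + 1).factorial_ne_zero
    have f3 := Nat.cast_ne_zero (R := ℚ).2 (N - α).factorial_ne_zero
    have f4 := Nat.cast_ne_zero (R := ℚ).2 (N + α - j).factorial_ne_zero
    have f5 := Nat.cast_ne_zero (R := ℚ).2 (j + 1 - α).factorial_ne_zero
    have f6 := Nat.cast_ne_zero (R := ℚ).2 α.factorial_ne_zero
    push_cast
    field_simp
    ring
  have quartic := sum_quartic_mul_choose_mul_choose N (j + 1) (by omega)
  rw [Finset.sum_congr rfl weight, ← Finset.sum_div]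
  rw [show j + 1 + 1 = j + 2 from rfl] at quartic
  generalize (Finset.sum (Finset.range (j + 2)) _ : ℚ) = T at quartic ⊢
  rw [Nat.cast_choose ℚ (show j + 1 ≤ 2 * N + 1 by omega),
    show 2 * N + 1 - (j + 1) = 2 * m + j + 2 by omega,
    show 2 * N + 1 = 2 * m + 2 * j + 3 by omega] at quartic
  rw [show 6 * i + 10 - j = 2 * m + j + 2 by omega, show 3 * i + 6 = m + j + 2 by omega,
    show 6 * i + 8 = 2 * m + 2 * j by omega, show 3 * i + 4 = m + j by omega,
    Nat.cast_choose ℚ (show m + j + 2 ≤ 2 * m + j + 2 by omega),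
    Nat.cast_choose ℚ (show j ≤ 2 * m + 2 * j by omega),
    Nat.cast_choose ℚ (show j ≤ m + j by omega),
    show 2 * m + j + 2 - (m + j + 2) = m by omega,
    show 2 * m + 2 * j - j = 2 * m + j by omega, Nat.add_sub_cancel]
  rw [hm] at quartic ⊢
  simp only [Nat.factorial_succ] at quartic ⊢
  push_cast at quartic ⊢
  have f1 := Nat.cast_ne_zero (R := ℚ).2 j.factorial_ne_zero
  have f2 := Nat.cast_ne_zero (R := ℚ).2 m.factorial_ne_zero
  have f3 := Nat.cast_ne_zero (R := ℚ).2 (m + j).factorial_ne_zero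
  have f4 := Nat.cast_ne_zero (R := ℚ).2 (2 * m + j).factorial_ne_zero
  have f5 := Nat.cast_ne_zero (R := ℚ).2 (2 * m + 2 * j).factorial_ne_zero
  field_simp at quartic ⊢
  have pos : (2 * (2 * m + j + 2) * (2 * m + 2 * j + 1) * (2 * m + j + 1) : ℚ) ≠ 0 := by
    positivity
  refine mul_left_cancel₀ pos ?_
  linear_combination quartic
end
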